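/- Let g ≥ 14 be an integer with g ≡ 2 (mod 4), let m = (g + 2)/4 + 1, and let P = conv{(2, 0), (m, 0), (m, 3), (m − 2, 5), (0, 5), (0, 2)} ⊆ ℝ² (the m × 5 rectangle with triangles of legs (2, 2) removed from the two antipodal corners (0, 0) and (m, 5)). Then P is a maximal lattice polygon with exactly g interior lattice points, lattice width 5, expected gonality 5, no column vectors, and g + r(P) − 3 = 3g/2 + 6. -/

import Mathlib

open Set

noncomputable section

/-- Embedding of the integer lattice `ℤ × ℤ` into the real plane. -/
def latticeEmbed (p : ℤ × ℤ) : ℝ × ℝ := ((p.1 : ℝ), (p.2 : ℝ))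

/-- A lattice polygon: the convex hull of a nonempty finite set of lattice points. -/
def IsLatticePolygon (P : Set (ℝ × ℝ)) : Prop :=
  ∃ S : Finset (ℤ × ℤ), S.Nonempty ∧
    P = convexHull ℝ (latticeEmbed '' (S : Set (ℤ × ℤ)))

/-- The interior lattice points of a set in the plane. -/
def interiorLatticePoints (P : Set (ℝ × ℝ)) : Set (ℤ × ℤ) :=
  {p : ℤ × ℤ | latticeEmbed p ∈ interior P}

/-- The genus of a lattice polygon: the number of interior lattice points. -/
def polygonGenus (P : Set (ℝ × ℝ)) : ℕ := (interiorLatticePoints P).ncard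

/-- The number of lattice points on the boundary. -/
def boundaryLatticeCount (P : Set (ℝ × ℝ)) : ℕ :=
  {p : ℤ × ℤ | latticeEmbed p ∈ frontier P}.ncard

/-- A subset of the plane is two-dimensional if it has nonempty interior. -/
def TwoDimensional (P : Set (ℝ × ℝ)) : Prop := (interior P).Nonempty

/-- A `ℤ`-affine transformation of the plane: `p ↦ A p + b` with `A ∈ GL₂(ℤ)`, `b ∈ ℤ²`. -/
def IsZAffine (φ : ℝ × ℝ → ℝ × ℝ) : Prop :=
  ∃ a b c d e f : ℤ, (a * d - b * c = 1 ∨ a * d - b * c = -1) ∧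
    ∀ p : ℝ × ℝ,
      φ p = ((a : ℝ) * p.1 + (b : ℝ) * p.2 + (e : ℝ),
             (c : ℝ) * p.1 + (d : ℝ) * p.2 + (f : ℝ))

/-- The horizontal strip `ℝ × [0, s]`. -/
def strip (s : ℝ) : Set (ℝ × ℝ) := {q : ℝ × ℝ | 0 ≤ q.2 ∧ q.2 ≤ s}

/-- `LatticeWidthIs P d` : `d` is the smallest positive integer `s` such that some
`ℤ`-affine transformation maps `P` into the strip `ℝ × [0, s]`. -/
def LatticeWidthIs (P : Set (ℝ × ℝ)) (d : ℕ) : Prop :=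
  IsLeast {s : ℕ | 0 < s ∧ ∃ φ, IsZAffine φ ∧ φ '' P ⊆ strip (s : ℝ)} d

/-- An edge of a polygon: an exposed face of dimension one. -/
def IsEdge (P τ : Set (ℝ × ℝ)) : Prop :=
  IsExposed ℝ P τ ∧ Module.finrank ℝ (vectorSpan ℝ τ) = 1

/-- A column vector of a polygon `P`: a nonzero integer vector `v` such that for some
edge `τ` of `P`, translating all lattice points of `P` off `τ` by `v` stays in `P`. -/
def IsColumnVector (P : Set (ℝ × ℝ)) (v : ℤ × ℤ) : Prop :=
  v ≠ 0 ∧ ∃ τ : Set (ℝ × ℝ), IsEdge P τ ∧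
    ∀ p : ℤ × ℤ, latticeEmbed p ∈ P \ τ → latticeEmbed (p + v) ∈ P

/-- The number of column vectors of `P`. -/
def columnVectorCount (P : Set (ℝ × ℝ)) : ℕ :=
  {v : ℤ × ℤ | IsColumnVector P v}.ncard

/-- A lattice polygon is maximal if no lattice polygon strictly containing it has the
same set of interior lattice points. -/
def IsMaximalPolygon (P : Set (ℝ × ℝ)) : Prop :=
  IsLatticePolygon P ∧
    ∀ Q : Set (ℝ × ℝ), IsLatticePolygon Q → P ⊆ Q →
      interiorLatticePoints Q = interiorLatticePoints P → Q = P

/-- The interior polygon: the convex hull of the interior lattice points. -/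
def interiorPolygon (P : Set (ℝ × ℝ)) : Set (ℝ × ℝ) :=
  convexHull ℝ (latticeEmbed '' interiorLatticePoints P)

/-- A lattice polygon is non-hyperelliptic if its interior polygon is two-dimensional. -/
def NonHyperelliptic (P : Set (ℝ × ℝ)) : Prop := TwoDimensional (interiorPolygon P)

/-- Two polygons are equivalent if one is the image of the other under a
`ℤ`-affine transformation. -/
def EquivPolygon (P Q : Set (ℝ × ℝ)) : Prop := ∃ φ, IsZAffine φ ∧ φ '' P = Q

/-- The triangle `2Υ = conv{(−2,−2),(2,0),(0,2)}`. -/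
def twoUpsilon : Set (ℝ × ℝ) :=
  convexHull ℝ {((-2 : ℝ), (-2 : ℝ)), ((2 : ℝ), (0 : ℝ)), ((0 : ℝ), (2 : ℝ))}

/-- `ExpectedGonalityIs P d` : the expected gonality of `P` is `d`, i.e.
`d = lw(P⁽¹⁾) + 2`, except that polygons equivalent to `2Υ` have expected gonality `3`. -/
def ExpectedGonalityIs (P : Set (ℝ × ℝ)) (d : ℕ) : Prop :=
  (EquivPolygon P twoUpsilon ∧ d = 3) ∨
  (¬ EquivPolygon P twoUpsilon ∧
    ∃ w : ℕ, LatticeWidthIs (interiorPolygon P) w ∧ d = w + 2)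

/-- `Q` contains a crystal of length `d`: a `(d+1) × (d−1)` grid of interior lattice
points occupying columns `x₀, …, x₀ + d` and rows `1, …, d − 1`. -/
def ContainsCrystal (Q : Set (ℝ × ℝ)) (d : ℕ) : Prop :=
  ∃ x₀ : ℤ, ∀ i j : ℤ, 0 ≤ i → i ≤ (d : ℤ) → 1 ≤ j → j ≤ (d : ℤ) - 1 →
    (x₀ + i, j) ∈ interiorLatticePoints Q

/-- The shear transformation `(x, y) ↦ (x + ℓ y, y)`. -/
def shearMap (ℓ : ℤ) : ℝ × ℝ → ℝ × ℝ := fun q => (q.1 + (ℓ : ℝ) * q.2, q.2)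

end

/-- The `m × 5` rectangle with triangles of legs `(2, 2)` removed from the antipodal
corners `(0, 0)` and `(m, 5)`. -/
def P19 (m : ℕ) : Set (ℝ × ℝ) :=
  convexHull ℝ {((2 : ℝ), (0 : ℝ)), ((m : ℝ), (0 : ℝ)), ((m : ℝ), (3 : ℝ)),
    ((m : ℝ) - 2, (5 : ℝ)), ((0 : ℝ), (5 : ℝ)), ((0 : ℝ), (2 : ℝ))}

/-- Half-plane description. -/
def R19 (m : ℕ) : Set (ℝ × ℝ) :=
  {p | 0 ≤ p.1 ∧ p.1 ≤ m ∧ 0 ≤ p.2 ∧ p.2 ≤ 5 ∧ 2 ≤ p.1 + p.2 ∧ p.1 + p.2 ≤ m + 3}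

lemma R19_convex (m : ℕ) : Convex ℝ (R19 m) := by
  rintro ⟨x, y⟩ ⟨h1, h2, h3, h4, h5, h6⟩ ⟨x', y'⟩ ⟨k1, k2, k3, k4, k5, k6⟩ a b ha hb hab
  simp only [R19, mem_ofPred_eq, Prod.smul_mk, Prod.mk_add_mk, smul_eq_mul] at *
  obtain rfl : b = 1 - a := by linarith
  refine ⟨?_, ?_, ?_, ?_, ?_, ?_⟩ <;> nlinarith

lemma seg_mem {C : Set (ℝ × ℝ)} (hC : Convex ℝ C) {p q r : ℝ × ℝ} (hp : p ∈ C) (hq : q ∈ C)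
    (t : ℝ) (h0 : 0 ≤ t) (h1 : t ≤ 1) (e1 : r.1 = (1 - t) * p.1 + t * q.1)
    (e2 : r.2 = (1 - t) * p.2 + t * q.2) : r ∈ C := by
  have := hC hp hq (sub_nonneg.2 h1) h0 (by ring)
  convert this using 1
  ext <;> simp [e1, e2]

lemma hseg {C : Set (ℝ × ℝ)} (hC : Convex ℝ C) {x1 x2 x y : ℝ} (hp : (x1, y) ∈ C)
    (hq : (x2, y) ∈ C) (h1 : x1 ≤ x) (h2 : x ≤ x2) : (x, y) ∈ C := by
  rcases eq_or_lt_of_le (h1.trans h2) with h | h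
  · obtain rfl : x = x1 := by linarith
    exact hp
  · have h' : x2 - x1 ≠ 0 := by linarith
    refine seg_mem hC hp hq ((x - x1) / (x2 - x1)) (div_nonneg (by linarith) (by linarith))
      ((div_le_one (by linarith)).2 (by linarith)) ?_ ?_
    · simp only
      field_simp
      ring
    · simp only
      ring

lemma P19_eq (m : ℕ) (hm : 5 ≤ m) : P19 m = R19 m := by
  have hm' : (5 : ℝ) ≤ m := by exact_mod_cast hm
  apply Subset.antisymm
  · refine convexHull_min ?_ (R19_convex m)
    intro p hp
    simp only [mem_insert_iff, mem_singleton_iff] at hp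
    rcases hp with rfl | rfl | rfl | rfl | rfl | rfl <;>
      refine ⟨?_, ?_, ?_, ?_, ?_, ?_⟩ <;> simp only <;> linarith
  · rintro ⟨x, y⟩ ⟨h1, h2, h3, h4, h5, h6⟩
    simp only at h1 h2 h3 h4 h5 h6
    have hC : Convex ℝ (P19 m) := convex_convexHull _ _
    have v1 : ((2 : ℝ), (0 : ℝ)) ∈ P19 m := subset_convexHull _ _ (by simp)
    have v2 : ((m : ℝ), (0 : ℝ)) ∈ P19 m := subset_convexHull _ _ (by simp)
    have v3 : ((m : ℝ), (3 : ℝ)) ∈ P19 m := subset_convexHull _ _ (by simp)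
    have v4 : ((m : ℝ) - 2, (5 : ℝ)) ∈ P19 m := subset_convexHull _ _ (by simp)
    have v5 : ((0 : ℝ), (5 : ℝ)) ∈ P19 m := subset_convexHull _ _ (by simp)
    have v6 : ((0 : ℝ), (2 : ℝ)) ∈ P19 m := subset_convexHull _ _ (by simp)
    have left : ∃ x1 ≤ x, (x1, y) ∈ P19 m := by
      by_cases hy : y ≤ 2
      · refine ⟨2 - y, by linarith, seg_mem hC v1 v6 (y / 2) ?_ ?_ ?_ ?_⟩ <;> (try simp only) <;> linarith
      · refine ⟨0, by linarith, seg_mem hC v6 v5 ((y - 2) / 3) ?_ ?_ ?_ ?_⟩ <;> (try simp only) <;>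
          linarith
    have right : ∃ x2, x ≤ x2 ∧ (x2, y) ∈ P19 m := by
      by_cases hy : y ≤ 3
      · refine ⟨m, by linarith, seg_mem hC v2 v3 (y / 3) ?_ ?_ ?_ ?_⟩ <;> (try simp only) <;> linarith
      · refine ⟨m + 3 - y, by linarith, seg_mem hC v3 v4 ((y - 3) / 2) ?_ ?_ ?_ ?_⟩ <;>
          (try simp only) <;> linarith
    obtain ⟨x1, a1, b1⟩ := left
    obtain ⟨x2, a2, b2⟩ := right
    exact hseg hC b1 b2 a1 a2

lemma R19_closed (m : ℕ) : IsClosed (R19 m) := by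
  have : R19 m = {p : ℝ × ℝ | 0 ≤ p.1} ∩ {p | p.1 ≤ m} ∩ {p | 0 ≤ p.2} ∩ {p | p.2 ≤ 5} ∩
      {p | 2 ≤ p.1 + p.2} ∩ {p | p.1 + p.2 ≤ m + 3} := by
    ext p
    simp only [R19, mem_inter_iff, mem_ofPred_eq]
    tauto
  rw [this]
  refine IsClosed.inter (IsClosed.inter (IsClosed.inter (IsClosed.inter (IsClosed.inter
    ?_ ?_) ?_) ?_) ?_) ?_ <;> exact isClosed_le (by fun_prop) (by fun_prop)

lemma R19_interior (m : ℕ) (p : ℝ × ℝ) : p ∈ interior (R19 m) ↔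
    (0 < p.1 ∧ p.1 < m ∧ 0 < p.2 ∧ p.2 < 5 ∧ 2 < p.1 + p.2 ∧ p.1 + p.2 < m + 3) := by
  constructor
  · intro h
    rw [mem_interior_iff_mem_nhds, Metric.mem_nhds_iff] at h
    obtain ⟨ε, he, hb⟩ := h
    have key : ∀ s t : ℝ, |s| ≤ ε / 2 → |t| ≤ ε / 2 → (p.1 + s, p.2 + t) ∈ R19 m := by
      intro s t hs ht
      apply hb
      rw [Metric.mem_ball, Prod.dist_eq, Real.dist_eq, Real.dist_eq]
      simp only [add_sub_cancel_left]
      exact max_lt (by linarith) (by linarith)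
    have a1 : |ε / 2| ≤ ε / 2 := (abs_of_pos (by linarith)).le
    have a2 : |-(ε / 2)| ≤ ε / 2 := by rw [abs_neg]; exact a1
    obtain ⟨h1, h2, h3, h4, h5, h6⟩ := key _ _ a1 a1
    obtain ⟨k1, k2, k3, k4, k5, k6⟩ := key _ _ a2 a2
    simp only at *
    refine ⟨?_, ?_, ?_, ?_, ?_, ?_⟩ <;> linarith
  · intro h
    let U : Set (ℝ × ℝ) := {p : ℝ × ℝ | 0 < p.1} ∩ {p | p.1 < m} ∩ {p | 0 < p.2} ∩ {p | p.2 < 5} ∩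
      {p | 2 < p.1 + p.2} ∩ {p | p.1 + p.2 < m + 3}
    have hU : IsOpen U := by
      refine IsOpen.inter (IsOpen.inter (IsOpen.inter (IsOpen.inter (IsOpen.inter
        ?_ ?_) ?_) ?_) ?_) ?_ <;> exact isOpen_lt (by fun_prop) (by fun_prop)
    refine interior_maximal (t := U) ?_ hU ?_
    · rintro q ⟨⟨⟨⟨⟨h1, h2⟩, h3⟩, h4⟩, h5⟩, h6⟩
      exact ⟨le_of_lt h1, le_of_lt h2, le_of_lt h3, le_of_lt h4, le_of_lt h5, le_of_lt h6⟩
    · obtain ⟨h1, h2, h3, h4, h5, h6⟩ := h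
      exact ⟨⟨⟨⟨⟨h1, h2⟩, h3⟩, h4⟩, h5⟩, h6⟩

lemma lat_mem (m : ℕ) (p : ℤ × ℤ) : latticeEmbed p ∈ R19 m ↔
    (0 ≤ p.1 ∧ p.1 ≤ m ∧ 0 ≤ p.2 ∧ p.2 ≤ 5 ∧ 2 ≤ p.1 + p.2 ∧ p.1 + p.2 ≤ m + 3) := by
  simp only [R19, latticeEmbed, mem_ofPred_eq]
  norm_cast

lemma lat_int (m : ℕ) (p : ℤ × ℤ) : p ∈ interiorLatticePoints (R19 m) ↔
    (0 < p.1 ∧ p.1 < m ∧ 0 < p.2 ∧ p.2 < 5 ∧ 2 < p.1 + p.2 ∧ p.1 + p.2 < m + 3) := by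
  simp only [interiorLatticePoints, mem_ofPred_eq, R19_interior, latticeEmbed]
  norm_cast

lemma int_eq (m : ℕ) (hm : 5 ≤ m) : interiorLatticePoints (R19 m) =
    (((Finset.Icc 1 ((m : ℤ) - 1)) ×ˢ (Finset.Icc 1 4)) \ {(1, 1), ((m : ℤ) - 1, 4)} :
      Finset (ℤ × ℤ)) := by
  ext ⟨x, y⟩
  rw [lat_int]
  simp only [Finset.coe_sdiff, mem_sdiff, Finset.mem_coe, Finset.mem_product, Finset.mem_Icc,
    Finset.mem_insert, Finset.mem_singleton, Prod.mk.injEq]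
  omega

lemma all_eq (m : ℕ) (hm : 5 ≤ m) : {p : ℤ × ℤ | latticeEmbed p ∈ R19 m} =
    (((Finset.Icc 0 (m : ℤ)) ×ˢ (Finset.Icc 0 5)) \ {(0, 0), (1, 0), (0, 1), ((m : ℤ), 5),
      ((m : ℤ) - 1, 5), ((m : ℤ), 4)} : Finset (ℤ × ℤ)) := by
  ext ⟨x, y⟩
  rw [mem_ofPred_eq, lat_mem]
  simp only [Finset.coe_sdiff, mem_sdiff, Finset.mem_coe, Finset.mem_product, Finset.mem_Icc,
    Finset.mem_insert, Finset.mem_singleton, Prod.mk.injEq]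
  omega

lemma genus_R (m : ℕ) (hm : 5 ≤ m) : (interiorLatticePoints (R19 m)).ncard = 4 * m - 6 := by
  rw [int_eq m hm, ncard_coe_finset, Finset.card_sdiff_of_subset, Finset.card_product,
    Finset.card_pair]
  · simp
    omega
  · simp
  · intro p hp
    simp only [Finset.mem_insert, Finset.mem_singleton] at hp
    rcases hp with rfl | rfl <;> simp <;> omega

lemma total_R (m : ℕ) (hm : 5 ≤ m) : {p : ℤ × ℤ | latticeEmbed p ∈ R19 m}.ncard = 6 * m := by
  have h6 : ({(0, 0), (1, 0), (0, 1), ((m : ℤ), 5),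
      ((m : ℤ) - 1, 5), ((m : ℤ), 4)} : Finset (ℤ × ℤ)).card = 6 := by
    repeat rw [Finset.card_insert_of_notMem
      (by simp only [Finset.mem_insert, Finset.mem_singleton, Prod.mk.injEq]; omega)]
    simp
  rw [all_eq m hm, ncard_coe_finset, Finset.card_sdiff_of_subset, Finset.card_product, h6]
  · simp
    omega
  · intro p hp
    simp only [Finset.mem_insert, Finset.mem_singleton] at hp
    rcases hp with rfl | rfl | rfl | rfl | rfl | rfl <;> simp <;> omega

lemma boundary_R (m : ℕ) (hm : 5 ≤ m) : boundaryLatticeCount (R19 m) = 2 * m + 6 := by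
  have : {p : ℤ × ℤ | latticeEmbed p ∈ frontier (R19 m)} =
      {p : ℤ × ℤ | latticeEmbed p ∈ R19 m} \ interiorLatticePoints (R19 m) := by
    ext p
    simp [(R19_closed m).frontier_eq, interiorLatticePoints]
  have hsub : interiorLatticePoints (R19 m) ⊆ {p : ℤ × ℤ | latticeEmbed p ∈ R19 m} := by
    intro p hp
    have hp' : latticeEmbed p ∈ interior (R19 m) := hp
    exact (interior_subset hp' : latticeEmbed p ∈ R19 m)
  have hfin : (interiorLatticePoints (R19 m)).Finite := by
    rw [int_eq m hm]
    exact Finset.finite_toSet _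
  rw [boundaryLatticeCount, this, ncard_sdiff hsub hfin, genus_R m hm, total_R m hm]
  omega

lemma lattice_P (m : ℕ) : IsLatticePolygon (P19 m) := by
  refine ⟨{(2, 0), ((m : ℤ), 0), ((m : ℤ), 3), ((m : ℤ) - 2, 5), (0, 5), (0, 2)}, by simp, ?_⟩
  simp [P19, latticeEmbed, image_insert_eq]

lemma push_out (m : ℕ) (Q : Set (ℝ × ℝ)) (hQ : Convex ℝ Q) (hPQ : R19 m ⊆ Q)
    (hi : interiorLatticePoints Q = interiorLatticePoints (R19 m)) (q : ℤ × ℤ)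
    (hq : latticeEmbed q ∈ Q) (M : ℤ × ℤ)
    (hM : M ∉ interiorLatticePoints (R19 m))
    (k1 : 0 < M.1 ∨ (M.1 = 0 ∧ q.1 < 0))
    (k2 : M.1 < m ∨ (M.1 = m ∧ m < q.1))
    (k3 : 0 < M.2 ∨ (M.2 = 0 ∧ q.2 < 0))
    (k4 : M.2 < 5 ∨ (M.2 = 5 ∧ 5 < q.2))
    (k5 : 2 < M.1 + M.2 ∨ (M.1 + M.2 = 2 ∧ q.1 + q.2 < 2))
    (k6 : M.1 + M.2 < m + 3 ∨ (M.1 + M.2 = m + 3 ∧ m + 3 < q.1 + q.2)) : False := by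
  apply hM
  rw [← hi]
  obtain ⟨a, b⟩ := q
  obtain ⟨u, v⟩ := M
  simp only [interiorLatticePoints, mem_ofPred_eq, latticeEmbed] at *
  set t : ℝ := 1 / (|(u : ℝ) - a| + |(v : ℝ) - b| + 1) with ht
  have n1 := abs_nonneg ((u : ℝ) - a)
  have n2 := abs_nonneg ((v : ℝ) - b)
  have tpos : 0 < t := by positivity
  have tD : t * |(u : ℝ) - a| + t * |(v : ℝ) - b| + t = 1 := by
    rw [ht]; field_simp
  have m1 : 0 ≤ t * |(u : ℝ) - a| := by positivity
  have m2 : 0 ≤ t * |(v : ℝ) - b| := by positivity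
  have b1 : |t * ((u : ℝ) - a)| = t * |(u : ℝ) - a| := by rw [abs_mul, abs_of_pos tpos]
  have b2 : |t * ((v : ℝ) - b)| = t * |(v : ℝ) - b| := by rw [abs_mul, abs_of_pos tpos]
  have c1 := le_abs_self (t * ((u : ℝ) - a))
  have c2 := neg_abs_le (t * ((u : ℝ) - a))
  have c3 := le_abs_self (t * ((v : ℝ) - b))
  have c4 := neg_abs_le (t * ((v : ℝ) - b))
  have hC : ((u : ℝ) + t * (u - a), (v : ℝ) + t * (v - b)) ∈ interior (R19 m) := by
    rw [R19_interior]
    refine ⟨?_, ?_, ?_, ?_, ?_, ?_⟩ <;> simp only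
    · rcases k1 with k | ⟨k, k'⟩
      · have : (1 : ℝ) ≤ u := by exact_mod_cast k
        linarith
      · have e : (u : ℝ) = 0 := by exact_mod_cast k
        have e' : (a : ℝ) < 0 := by exact_mod_cast k'
        nlinarith
    · rcases k2 with k | ⟨k, k'⟩
      · have : (u : ℝ) + 1 ≤ m := by exact_mod_cast k
        linarith
      · have e : (u : ℝ) = m := by exact_mod_cast k
        have e' : (m : ℝ) < a := by exact_mod_cast k'
        nlinarith
    · rcases k3 with k | ⟨k, k'⟩
      · have : (1 : ℝ) ≤ v := by exact_mod_cast k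
        linarith
      · have e : (v : ℝ) = 0 := by exact_mod_cast k
        have e' : (b : ℝ) < 0 := by exact_mod_cast k'
        nlinarith
    · rcases k4 with k | ⟨k, k'⟩
      · have : (v : ℝ) + 1 ≤ 5 := by exact_mod_cast k
        linarith
      · have e : (v : ℝ) = 5 := by exact_mod_cast k
        have e' : (5 : ℝ) < b := by exact_mod_cast k'
        nlinarith
    · rcases k5 with k | ⟨k, k'⟩
      · have : (2 : ℝ) + 1 ≤ u + v := by exact_mod_cast k
        linarith
      · have e : (u : ℝ) + v = 2 := by exact_mod_cast k
        have e' : (a : ℝ) + b < 2 := by exact_mod_cast k'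
        nlinarith
    · rcases k6 with k | ⟨k, k'⟩
      · have : (u : ℝ) + v + 1 ≤ m + 3 := by exact_mod_cast k
        linarith
      · have e : (u : ℝ) + v = m + 3 := by exact_mod_cast k
        have e' : (m : ℝ) + 3 < a + b := by exact_mod_cast k'
        nlinarith
  refine hQ.openSegment_interior_self_subset_interior (interior_mono hPQ hC) hq ?_
  have t1 : 0 < 1 + t := by linarith
  refine ⟨1 / (1 + t), t / (1 + t), by positivity, by positivity, by field_simp, ?_⟩
  ext <;> simp <;> field_simp <;> ring

lemma maximal_P (m : ℕ) (hm : 5 ≤ m) : IsMaximalPolygon (P19 m) := by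
  refine ⟨lattice_P m, ?_⟩
  rw [P19_eq m hm]
  rintro Q ⟨S, -, rfl⟩ hPQ hi
  refine Subset.antisymm (convexHull_min ?_ (R19_convex m)) hPQ
  rintro _ ⟨q, hq, rfl⟩
  have hq' := subset_convexHull ℝ _ (mem_image_of_mem latticeEmbed hq)
  have key := push_out m _ (convex_convexHull ℝ _) hPQ hi q hq'
  rw [lat_mem]
  simp only [lat_int] at key
  refine ⟨?_, ?_, ?_, ?_, ?_, ?_⟩ <;> by_contra hc
  · apply key (0, 3) <;> simp <;> omega
  · apply key ((m : ℤ), 1) <;> simp <;> omega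
  · apply key (3, 0) <;> simp <;> omega
  · apply key (1, 5) <;> simp <;> omega
  · apply key (1, 1) <;> simp <;> omega
  · apply key ((m : ℤ) - 1, 4) <;> simp <;> omega

/-- If the row and column segments are long, the width is large. -/
lemma width_lower (Q : Set (ℝ × ℝ)) (s : ℕ) (φ : ℝ × ℝ → ℝ × ℝ) (hφ : IsZAffine φ)
    (h : φ '' Q ⊆ strip (s : ℝ)) (x y x' y' L K : ℤ)
    (h1 : latticeEmbed (x, y) ∈ Q) (h2 : latticeEmbed (x + L, y) ∈ Q)
    (h3 : latticeEmbed (x', y') ∈ Q) (h4 : latticeEmbed (x', y' + K) ∈ Q)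
    (hL : (s : ℤ) < L) (hK : (s : ℤ) < K) : False := by
  obtain ⟨a, b, c, d, e, f, hdet, hf⟩ := hφ
  have key : ∀ u v : ℤ, latticeEmbed (u, v) ∈ Q → 0 ≤ c * u + d * v + f ∧
      c * u + d * v + f ≤ s := by
    intro u v huv
    have := h (mem_image_of_mem φ huv)
    rw [hf] at this
    simp only [strip, latticeEmbed, mem_ofPred_eq] at this
    exact_mod_cast this
  have i1 := key _ _ h1
  have i2 := key _ _ h2
  have i3 := key _ _ h3
  have i4 := key _ _ h4
  have hs : (0 : ℤ) ≤ s := by positivity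
  have hc : c = 0 := by
    rcases lt_trichotomy c 0 with hc | hc | hc
    · nlinarith
    · exact hc
    · nlinarith
  have hd : d = 0 := by
    rcases lt_trichotomy d 0 with hc | hc | hc
    · nlinarith
    · exact hc
    · nlinarith
  subst hc hd
  omega

lemma width_R_lower (m : ℕ) (hm : 5 ≤ m) (s : ℕ) (φ : ℝ × ℝ → ℝ × ℝ) (hφ : IsZAffine φ)
    (h : φ '' (R19 m) ⊆ strip (s : ℝ)) : 5 ≤ s := by
  by_contra hs
  refine width_lower _ s φ hφ h 0 2 2 0 m 5 ?_ ?_ ?_ ?_ ?_ ?_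
  iterate 4 (rw [lat_mem]; simp only; omega)
  all_goals omega

lemma width_R (m : ℕ) (hm : 5 ≤ m) : LatticeWidthIs (R19 m) 5 := by
  refine ⟨⟨by norm_num, id, ⟨1, 0, 0, 1, 0, 0, by norm_num, by intro p; simp⟩, ?_⟩, ?_⟩
  · rintro _ ⟨p, ⟨_, _, h3, h4, _⟩, rfl⟩
    exact ⟨h3, by simpa using h4⟩
  · rintro s ⟨_, φ, hφ, h⟩
    exact width_R_lower m hm s φ hφ h

lemma width_int (m : ℕ) (hm : 5 ≤ m) : LatticeWidthIs (interiorPolygon (R19 m)) 3 := by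
  constructor
  · refine ⟨by norm_num, fun p => (p.1, p.2 - 1),
      ⟨1, 0, 0, 1, 0, -1, by norm_num, by intro p; simp [sub_eq_add_neg]⟩, ?_⟩
    rw [image_subset_iff]
    refine convexHull_min ?_ ?_
    · rintro _ ⟨p, hp, rfl⟩
      rw [lat_int] at hp
      have h1 : (1 : ℝ) ≤ p.2 := by exact_mod_cast hp.2.2.1
      have h2 : (p.2 : ℝ) + 1 ≤ 5 := by exact_mod_cast hp.2.2.2.1
      simp only [strip, latticeEmbed, mem_preimage, mem_ofPred_eq]
      push_cast
      constructor <;> linarith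
    · rintro ⟨x, y⟩ h ⟨x', y'⟩ h' a b ha hb hab
      simp only [strip, mem_preimage, mem_ofPred_eq, Prod.smul_mk, Prod.mk_add_mk, smul_eq_mul] at *
      obtain rfl : b = 1 - a := by linarith
      push_cast at *
      constructor <;> nlinarith
  · rintro s ⟨_, φ, hφ, h⟩
    by_contra hs
    have key : ∀ p : ℤ × ℤ, p ∈ interiorLatticePoints (R19 m) →
      latticeEmbed p ∈ interiorPolygon (R19 m) := fun p hp =>
        subset_convexHull ℝ _ (mem_image_of_mem _ hp)
    refine width_lower _ s φ hφ h 1 2 2 1 (m - 2) 3 ?_ ?_ ?_ ?_ ?_ ?_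
    iterate 4 (apply key; rw [lat_int]; simp only; omega)
    all_goals omega

lemma not_equiv (m : ℕ) (hm : 5 ≤ m) : ¬ EquivPolygon (R19 m) twoUpsilon := by
  rintro ⟨φ, ⟨a, b, c, d, e, f, hdet, hf⟩, h⟩
  have : 5 ≤ 4 := by
    refine width_R_lower m hm 4 (fun p => ((φ p).1, (φ p).2 + 2))
      ⟨a, b, c, d, e, f + 2, hdet, ?_⟩ ?_
    · intro p
      simp [hf, add_assoc]
    · have hU : twoUpsilon ⊆ {p : ℝ × ℝ | -2 ≤ p.2 ∧ p.2 ≤ 2} := by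
        refine convexHull_min ?_ ?_
        · intro p hp
          simp only [mem_insert_iff, mem_singleton_iff] at hp
          rcases hp with rfl | rfl | rfl <;> norm_num
        · rintro ⟨x, y⟩ h ⟨x', y'⟩ h' a b ha hb hab
          simp only [mem_ofPred_eq, Prod.smul_mk, Prod.mk_add_mk, smul_eq_mul] at *
          obtain rfl : b = 1 - a := by linarith
          constructor <;> nlinarith
      rintro _ ⟨p, hp, rfl⟩
      have := hU (h ▸ mem_image_of_mem φ hp)
      simp only [mem_ofPred_eq, strip] at *
      push_cast
      constructor <;> linarith
  omega

lemma collinear_det {τ : Set (ℝ × ℝ)} (h : Module.finrank ℝ (vectorSpan ℝ τ) = 1)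
    {p q r : ℤ × ℤ} (hp : latticeEmbed p ∈ τ) (hq : latticeEmbed q ∈ τ)
    (hr : latticeEmbed r ∈ τ) :
    (q.1 - p.1) * (r.2 - p.2) = (q.2 - p.2) * (r.1 - p.1) := by
  have hc : Collinear ℝ τ := collinear_iff_finrank_le_one.2 h.le
  obtain ⟨w, hw⟩ := (collinear_iff_of_mem hp).1 hc
  obtain ⟨s, hs⟩ := hw _ hq
  obtain ⟨t, ht⟩ := hw _ hr
  simp only [latticeEmbed, vadd_eq_add, Prod.ext_iff, Prod.fst_add, Prod.snd_add, Prod.smul_fst,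
    Prod.smul_snd, smul_eq_mul] at hs ht
  have : ((q.1 : ℝ) - p.1) * (r.2 - p.2) = (q.2 - p.2) * (r.1 - p.1) := by
    rw [hs.1, hs.2, ht.1, ht.2]
    ring
  exact_mod_cast this

lemma no_column (m : ℕ) (hm : 5 ≤ m) (v : ℤ × ℤ) : ¬ IsColumnVector (R19 m) v := by
  rintro ⟨hv, τ, ⟨-, hτ⟩, h⟩
  obtain ⟨a, b⟩ := v
  have key : ∀ x y : ℤ, latticeEmbed (x, y) ∈ R19 m → latticeEmbed (x + a, y + b) ∉ R19 m →
      latticeEmbed (x, y) ∈ τ := by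
    intro x y h1 h2
    by_contra h3
    exact h2 (h (x, y) ⟨h1, h3⟩)
  simp only [lat_mem] at key
  have hab : ¬ (a = 0 ∧ b = 0) := fun h => hv (by simp [h.1, h.2])
  have X : a ≠ 0 → ∃ x y z : ℤ, y < z ∧ latticeEmbed (x, y) ∈ τ ∧ latticeEmbed (x, z) ∈ τ := by
    intro ha
    rcases lt_or_gt_of_ne ha with ha | ha
    · exact ⟨0, 2, 5, by omega, key _ _ (by omega) (by omega), key _ _ (by omega) (by omega)⟩
    · exact ⟨m, 0, 3, by omega, key _ _ (by omega) (by omega), key _ _ (by omega) (by omega)⟩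
  have Y : b ≠ 0 → ∃ x y z : ℤ, y < z ∧ latticeEmbed (y, x) ∈ τ ∧ latticeEmbed (z, x) ∈ τ := by
    intro ha
    rcases lt_or_gt_of_ne ha with ha | ha
    · exact ⟨0, 2, m, by omega, key _ _ (by omega) (by omega), key _ _ (by omega) (by omega)⟩
    · exact ⟨5, 0, m - 2, by omega, key _ _ (by omega) (by omega), key _ _ (by omega) (by omega)⟩
  have Z : a + b ≠ 0 → ∃ x y : ℤ, latticeEmbed (x, y) ∈ τ ∧ latticeEmbed (x - 2, y + 2) ∈ τ := by
    intro ha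
    rcases lt_or_gt_of_ne ha with ha | ha
    · exact ⟨2, 0, key _ _ (by omega) (by omega), key _ _ (by omega) (by omega)⟩
    · exact ⟨m, 3, key _ _ (by omega) (by omega), key _ _ (by omega) (by omega)⟩
  by_cases ha : a = 0
  · have hb : b ≠ 0 := fun hb => hab ⟨ha, hb⟩
    have hc : a + b ≠ 0 := by rw [ha, zero_add]; exact hb
    obtain ⟨x, y, z, hyz, p1, p2⟩ := Y hb
    obtain ⟨u, w, q1, q2⟩ := Z hc
    have e1 := collinear_det hτ p1 p2 q1
    have e2 := collinear_det hτ p1 p2 q2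
    simp only at e1 e2
    nlinarith
  · obtain ⟨x, y, z, hyz, p1, p2⟩ := X ha
    by_cases hb : b = 0
    · have hc : a + b ≠ 0 := by rw [hb, add_zero]; exact ha
      obtain ⟨u, w, q1, q2⟩ := Z hc
      have e1 := collinear_det hτ p1 p2 q1
      have e2 := collinear_det hτ p1 p2 q2
      simp only at e1 e2
      nlinarith
    · obtain ⟨u, w, w', hw, q1, q2⟩ := Y hb
      have e1 := collinear_det hτ p1 p2 q1
      have e2 := collinear_det hτ p1 p2 q2
      simp only at e1 e2
      nlinarith

/-- For `g ≥ 14` with `g ≡ 2 (mod 4)` and `m = (g + 2)/4 + 1`, the polygon `P19 m` is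
a maximal lattice polygon of genus `g`, lattice width `5`, expected gonality `5`, has
no column vectors, and satisfies `g + r(P) − 3 = 3g/2 + 6`. -/
theorem stmt19 (g : ℕ) (hg : 14 ≤ g) (hmod : g % 4 = 2) :
    IsMaximalPolygon (P19 ((g + 2) / 4 + 1)) ∧
    polygonGenus (P19 ((g + 2) / 4 + 1)) = g ∧
    LatticeWidthIs (P19 ((g + 2) / 4 + 1)) 5 ∧
    ExpectedGonalityIs (P19 ((g + 2) / 4 + 1)) 5 ∧
    (∀ v : ℤ × ℤ, ¬ IsColumnVector (P19 ((g + 2) / 4 + 1)) v) ∧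
    (g : ℚ) + (boundaryLatticeCount (P19 ((g + 2) / 4 + 1)) : ℚ) - 3 =
      3 * (g : ℚ) / 2 + 6 := by
  obtain ⟨m, hm, hgm, hm5⟩ : ∃ m, (g + 2) / 4 + 1 = m ∧ g = 4 * m - 6 ∧ 5 ≤ m :=
    ⟨_, rfl, by omega, by omega⟩
  rw [hm]
  refine ⟨maximal_P m hm5, ?_⟩
  rw [P19_eq m hm5]
  refine ⟨(genus_R m hm5).trans hgm.symm, width_R m hm5,
    Or.inr ⟨not_equiv m hm5, 3, width_int m hm5, rfl⟩, no_column m hm5, ?_⟩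
  rw [boundary_R m hm5]
  have : (g : ℚ) = 4 * m - 6 := by
    have : g + 6 = 4 * m := by omega
    have : (g : ℚ) + 6 = 4 * m := by exact_mod_cast this
    linarith
  rw [this]
  push_cast
  ring
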